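/- Every countable left-orderable group embeds into Homeo₊(ℝ); consequently, since the direct sum of uncountably many copies of a non-Abelian left-orderable group (e.g. the free group F₂) is left-orderable but does not embed into Homeo₊(ℝ), there exists a left-orderable group of continuum cardinality that does not embed into Homeo₊(ℝ). -/

import Mathlib

/-- A group is left-orderable if it admits a strict total order invariant
under left multiplication. -/
def LeftOrderable (G : Type*) [Group G] : Prop :=
  ∃ lt : G → G → Prop, IsStrictTotalOrder G lt ∧
    ∀ f g h : G, lt g h → lt (f * g) (f * h)

/-- The group of orientation-preserving homeomorphisms of the real line,
identified with the group of order-isomorphisms of `ℝ`. -/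
abbrev HomeoPlusR := ℝ ≃o ℝ

/-- `G` embeds into `Homeo₊(ℝ)`. -/
def EmbedsInHomeoPlusR (G : Type*) [Group G] : Prop :=
  ∃ φ : G →* HomeoPlusR, Function.Injective φ

section RatExt

/-- The extension of an order automorphism of `ℚ` to `ℝ`. -/
noncomputable def ratExt (f : ℚ ≃o ℚ) (x : ℝ) : ℝ :=
  sSup {y : ℝ | ∃ r : ℚ, (r : ℝ) < x ∧ ((f r : ℚ) : ℝ) = y}

theorem ratExt_iff (f : ℚ ≃o ℚ) (x : ℝ) (q : ℚ) :
    (q : ℝ) < ratExt f x ↔ ((f.symm q : ℚ) : ℝ) < x := by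
  obtain ⟨r0, hr0⟩ := exists_rat_lt x
  obtain ⟨r1, hr1⟩ := exists_rat_gt x
  have hne : {y : ℝ | ∃ r : ℚ, (r : ℝ) < x ∧ ((f r : ℚ) : ℝ) = y}.Nonempty :=
    ⟨_, r0, hr0, rfl⟩
  have hbdd : BddAbove {y : ℝ | ∃ r : ℚ, (r : ℝ) < x ∧ ((f r : ℚ) : ℝ) = y} := by
    refine ⟨((f r1 : ℚ) : ℝ), ?_⟩
    rintro _ ⟨r, hr, rfl⟩
    have : r < r1 := by exact_mod_cast hr.trans hr1
    exact_mod_cast (f.strictMono this).le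
  constructor
  · intro h
    obtain ⟨_, ⟨r, hr, rfl⟩, h2⟩ := exists_lt_of_lt_csSup hne h
    have h3 : q < f r := by exact_mod_cast h2
    have h4 : f.symm q < r := by
      rw [← f.lt_iff_lt]; simpa using h3
    have h5 : ((f.symm q : ℚ) : ℝ) < r := by exact_mod_cast h4
    exact h5.trans hr
  · intro h
    obtain ⟨r, hr, hrx⟩ := exists_rat_btwn h
    have h4 : f.symm q < r := by exact_mod_cast hr
    have h3 : q < f r := by
      have := f.strictMono h4
      simpa using this
    have h5 : (q : ℝ) < ((f r : ℚ) : ℝ) := by exact_mod_cast h3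
    exact h5.trans_le (le_csSup hbdd ⟨r, hrx, rfl⟩)

theorem le_of_rat_lt {x y : ℝ} (h : ∀ q : ℚ, (q : ℝ) < x → (q : ℝ) < y) : x ≤ y := by
  by_contra hc
  obtain ⟨q, h1, h2⟩ := exists_rat_btwn (not_le.1 hc)
  exact absurd (h q h2) (not_lt.2 h1.le)

theorem eq_of_rat_lt {x y : ℝ} (h : ∀ q : ℚ, (q : ℝ) < x ↔ (q : ℝ) < y) : x = y :=
  le_antisymm (le_of_rat_lt fun q => (h q).1) (le_of_rat_lt fun q => (h q).2)

theorem ratExt_mono (f : ℚ ≃o ℚ) : Monotone (ratExt f) := by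
  intro x y hxy
  refine le_of_rat_lt fun q hq => ?_
  rw [ratExt_iff] at hq ⊢
  exact hq.trans_le hxy

theorem ratExt_mul (f g : ℚ ≃o ℚ) (x : ℝ) : ratExt (f * g) x = ratExt f (ratExt g x) := by
  refine eq_of_rat_lt fun q => ?_
  rw [ratExt_iff, ratExt_iff, ratExt_iff]
  rfl

theorem ratExt_one (x : ℝ) : ratExt 1 x = x := by
  refine eq_of_rat_lt fun q => ?_
  rw [ratExt_iff]
  rfl

/-- The extension as an order automorphism of `ℝ`. -/
noncomputable def ratExtIso (f : ℚ ≃o ℚ) : ℝ ≃o ℝ :=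
  Equiv.toOrderIso
    { toFun := ratExt f
      invFun := ratExt f⁻¹
      left_inv := fun x => by rw [← ratExt_mul, inv_mul_cancel, ratExt_one]
      right_inv := fun x => by rw [← ratExt_mul, mul_inv_cancel, ratExt_one] }
    (ratExt_mono f) (ratExt_mono f⁻¹)

/-- Extension as a group homomorphism. -/
noncomputable def ratExtHom : (ℚ ≃o ℚ) →* (ℝ ≃o ℝ) where
  toFun := ratExtIso
  map_one' := by
    ext x
    exact ratExt_one x
  map_mul' f g := by
    ext x
    exact ratExt_mul f g x

theorem ratExtHom_injective : Function.Injective ratExtHom := by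
  intro f g h
  have key : ∀ q : ℚ, f.symm q = g.symm q := by
    intro q
    have hx : ∀ x : ℝ, ((f.symm q : ℚ) : ℝ) < x ↔ ((g.symm q : ℚ) : ℝ) < x := by
      intro x
      rw [← ratExt_iff, ← ratExt_iff]
      have : ratExt f x = ratExt g x := congrArg (fun e : ℝ ≃o ℝ => e x) h
      rw [this]
    have := eq_of_forall_gt_iff (a := ((f.symm q : ℚ) : ℝ)) (b := ((g.symm q : ℚ) : ℝ)) ?_
    · exact_mod_cast this
    · exact hx
  ext q
  have := key (f q)
  rw [OrderIso.symm_apply_apply] at this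
  conv_rhs => rw [this]
  simp

end RatExt

theorem countable_part (G : Type) [Group G] [Countable G] (h : LeftOrderable G) :
    EmbedsInHomeoPlusR G := by
  classical
  obtain ⟨lt, hlt, hinv⟩ := h
  let _ : LinearOrder G := linearOrderOfSTO lt
  have hmul : ∀ f : G, StrictMono fun g : G => f * g := fun f a b hab => hinv f a b hab
  have : Countable (G ×ₗ ℚ) := inferInstanceAs (Countable (G × ℚ))
  have : Nonempty (G ×ₗ ℚ) := ⟨toLex (1, 0)⟩
  obtain ⟨e⟩ := Order.iso_of_countable_dense (G ×ₗ ℚ) ℚ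
  let actE : G → (G ×ₗ ℚ) ≃ (G ×ₗ ℚ) := fun g =>
    { toFun := fun p => toLex (g * (ofLex p).1, (ofLex p).2)
      invFun := fun p => toLex (g⁻¹ * (ofLex p).1, (ofLex p).2)
      left_inv := fun p => by simp
      right_inv := fun p => by simp }
  have hmono : ∀ g, Monotone (actE g) := by
    intro g p q hpq
    rw [Prod.Lex.le_iff] at hpq ⊢
    rcases hpq with h | ⟨h1, h2⟩
    · exact Or.inl (hmul g h)
    · exact Or.inr ⟨congrArg (g * ·) h1, h2⟩
  have hsymm : ∀ g, (actE g).symm = actE g⁻¹ := by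
    intro g; ext p <;> rfl
  let act : G → (G ×ₗ ℚ) ≃o (G ×ₗ ℚ) := fun g =>
    (actE g).toOrderIso (hmono g) (by rw [hsymm]; exact hmono _)
  have act_apply : ∀ g p, act g p = toLex (g * (ofLex p).1, (ofLex p).2) := fun _ _ => rfl
  let ψ : G →* (ℚ ≃o ℚ) :=
    { toFun := fun g => (e.symm.trans (act g)).trans e
      map_one' := by
        ext q
        simp [act_apply]
      map_mul' := fun g k => by
        ext q
        simp [act_apply, mul_assoc] }
  refine ⟨ratExtHom.comp ψ, ratExtHom_injective.comp ?_⟩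
  intro g k hgk
  have h1 : e (act g (e.symm (e (toLex (1, 0))))) = e (act k (e.symm (e (toLex (1, 0))))) :=
    congrArg (fun f : ℚ ≃o ℚ => f (e (toLex (1, 0)))) hgk
  have h2 := e.injective h1
  simpa [act_apply] using h2

section Twisted

/-- The twisted group: finitely supported functions `ℝ → ℤ`, generated by `g_r`, `r : ℝ`, with
`g_a⁻¹ g_b g_a = g_b⁻¹` for `a < b`. -/
def TwG := ℝ →₀ ℤ

/-- The sign character. -/
noncomputable def chi (v : ℝ →₀ ℤ) (s : ℝ) : ℤˣ :=
  v.prod fun r n => if r < s then n.negOnePow else 1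

/-- The twisted product. -/
noncomputable def twMul (u v : ℝ →₀ ℤ) : ℝ →₀ ℤ :=
  Finsupp.onFinset (u.support ∪ v.support) (fun s => u s * (chi v s : ℤ) + v s) (by
    intro s hs
    by_contra hc
    simp only [Finset.mem_union, Finsupp.mem_support_iff, not_or, not_not] at hc
    simp [hc.1, hc.2] at hs)

/-- The twisted inverse. -/
noncomputable def twInv (u : ℝ →₀ ℤ) : ℝ →₀ ℤ :=
  Finsupp.onFinset u.support (fun s => -(u s * (chi u s : ℤ))) (by
    intro s hs
    rw [Finsupp.mem_support_iff]
    intro hc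
    simp [hc] at hs)

theorem twMul_apply (u v : ℝ →₀ ℤ) (s : ℝ) : twMul u v s = u s * (chi v s : ℤ) + v s := rfl

theorem twInv_apply (u : ℝ →₀ ℤ) (s : ℝ) : twInv u s = -(u s * (chi u s : ℤ)) := rfl

theorem negOnePow_mul_unit (n : ℤ) (e : ℤˣ) : (n * (e : ℤ)).negOnePow = n.negOnePow := by
  rcases Int.units_eq_one_or e with rfl | rfl <;> simp

theorem chi_eq (v : ℝ →₀ ℤ) (s : ℝ) (S : Finset ℝ) (h : v.support ⊆ S) :
    chi v s = ∏ r ∈ S, if r < s then (v r).negOnePow else 1 :=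
  Finsupp.prod_of_support_subset _ h _ (by intros; simp)

theorem chi_mul (u v : ℝ →₀ ℤ) (s : ℝ) : chi (twMul u v) s = chi u s * chi v s := by
  classical
  rw [chi_eq (twMul u v) s (u.support ∪ v.support) Finsupp.support_onFinset_subset,
    chi_eq u s (u.support ∪ v.support) Finset.subset_union_left,
    chi_eq v s (u.support ∪ v.support) Finset.subset_union_right, ← Finset.prod_mul_distrib]
  refine Finset.prod_congr rfl fun r _ => ?_
  split_ifs
  · rw [twMul_apply, Int.negOnePow_add, negOnePow_mul_unit]
  · simp

theorem chi_congr (u v : ℝ →₀ ℤ) (s : ℝ) (h : ∀ r < s, u r = v r) : chi u s = chi v s := by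
  classical
  rw [chi_eq u s (u.support ∪ v.support) Finset.subset_union_left,
    chi_eq v s (u.support ∪ v.support) Finset.subset_union_right]
  refine Finset.prod_congr rfl fun r _ => ?_
  split_ifs with hr
  · rw [h r hr]
  · rfl

theorem chi_zero (s : ℝ) : chi 0 s = 1 := by simp [chi]

theorem chi_sq (u : ℝ →₀ ℤ) (s : ℝ) : (chi u s : ℤ) * (chi u s : ℤ) = 1 := by
  rw [← Units.val_mul, Int.units_mul_self, Units.val_one]

theorem tw_assoc (u v w : ℝ →₀ ℤ) : twMul (twMul u v) w = twMul u (twMul v w) := by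
  refine Finsupp.ext fun s => ?_
  simp only [twMul_apply, chi_mul, Units.val_mul]
  ring

theorem tw_zero (u : ℝ →₀ ℤ) : twMul 0 u = u := by
  refine Finsupp.ext fun s => ?_
  simp [twMul_apply]

theorem tw_inv (u : ℝ →₀ ℤ) : twMul (twInv u) u = 0 := by
  refine Finsupp.ext fun s => ?_
  rw [twMul_apply, twInv_apply, Finsupp.zero_apply]
  linear_combination (- u s) * chi_sq u s

theorem tw_lt (f g h : ℝ →₀ ℤ) (hgh : toLex g < toLex h) :
    toLex (twMul f g) < toLex (twMul f h) := by
  obtain ⟨s, hs1, hs2⟩ := hgh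
  have hs1' : ∀ r < s, g r = h r := hs1
  have hs2' : g s < h s := hs2
  refine ⟨s, ?_, ?_⟩
  · intro r hr
    change twMul f g r = twMul f h r
    rw [twMul_apply, twMul_apply, hs1' r hr,
      chi_congr g h r fun q hq => hs1' q (hq.trans hr)]
  · change twMul f g s < twMul f h s
    rw [twMul_apply, twMul_apply, chi_congr g h s hs1']
    linarith

noncomputable instance : Group TwG :=
  @Group.ofLeftAxioms TwG ⟨twMul⟩ ⟨twInv⟩ ⟨(0 : ℝ →₀ ℤ)⟩ tw_assoc tw_zero tw_inv

theorem TwG.leftOrderable : LeftOrderable TwG :=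
  ⟨fun u v => toLex (α := ℝ →₀ ℤ) u < toLex (α := ℝ →₀ ℤ) v,
    inferInstanceAs (IsStrictTotalOrder (Lex (ℝ →₀ ℤ)) (· < ·)), tw_lt⟩

/-- The generators. -/
noncomputable def TwG.gen (r : ℝ) : TwG := Finsupp.single r (1 : ℤ)

theorem TwG.gen_ne_one (r : ℝ) : TwG.gen r ≠ 1 := by
  intro h
  have : (Finsupp.single r (1 : ℤ) : ℝ →₀ ℤ) = 0 := h
  simp at this

theorem chi_single (r s : ℝ) : chi (Finsupp.single r 1) s = if r < s then -1 else 1 := by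
  rw [chi, Finsupp.prod_single_index]
  · simp
  · simp

/-- The defining relation, in the form `g_b g_a g_b = g_a`. -/
theorem TwG.rel {a b : ℝ} (hab : a < b) :
    TwG.gen b * (TwG.gen a * TwG.gen b) = TwG.gen a := by
  refine Finsupp.ext fun s => ?_
  change twMul (Finsupp.single b 1) (twMul (Finsupp.single a 1) (Finsupp.single b 1)) s
    = Finsupp.single a (1 : ℤ) s
  rw [twMul_apply, twMul_apply, chi_mul, chi_single, chi_single]
  rcases eq_or_ne s a with rfl | ha
  · simp [hab.ne', hab, hab.le, Finsupp.single_apply, not_lt.2 hab.le]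
  · rcases eq_or_ne s b with rfl | hb
    · simp [hab.ne, hab, Finsupp.single_apply]
    · simp [ha.symm, hb.symm, Finsupp.single_apply]

theorem line_lemma {a s : ℝ ≃o ℝ} (h : s * (a * s) = a) {x : ℝ} (hs : x < s x) :
    a x ≠ x ∧ (x < a x → s x < a x) := by
  have h1 : s (a (s x)) = a x := congrArg (fun e : ℝ ≃o ℝ => e x) h
  have h2 : a x < a (s x) := a.strictMono hs
  have h3 : s (a x) < a x := by
    have := s.strictMono h2
    rwa [h1] at this
  refine ⟨fun h => ?_, fun h => ?_⟩
  · rw [h] at h3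
    exact lt_asymm h3 hs
  · by_contra hc
    rw [not_lt, ← h1, s.le_iff_le] at hc
    exact lt_asymm h (h2.trans_le hc)

theorem rel_inv_left {H : Type*} [Group H] {a s : H} (h : s * (a * s) = a) :
    s⁻¹ * (a * s⁻¹) = a := by
  calc s⁻¹ * (a * s⁻¹) = s⁻¹ * ((s * (a * s)) * s⁻¹) := by rw [h]
    _ = a := by group

theorem rel_inv_right {H : Type*} [Group H] {a s : H} (h : s * (a * s) = a) :
    s * (a⁻¹ * s) = a⁻¹ := by
  have h2 := congrArg (fun z => z⁻¹) (rel_inv_left h)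
  simpa [mul_assoc] using h2

theorem rel_sq {H : Type*} [Group H] {a s : H} (h : s * (a * s) = a) :
    (s * s) * (a * (s * s)) = a := by
  calc (s * s) * (a * (s * s)) = s * ((s * (a * s)) * s) := by group
    _ = a := by rw [h, h]

theorem TwG.not_embeds : ¬ EmbedsInHomeoPlusR TwG := by
  rintro ⟨φ, hφ⟩
  have hrel : ∀ a b : ℝ, a < b → φ (gen b) * (φ (gen a) * φ (gen b)) = φ (gen a) := by
    intro a b hab
    rw [← map_mul, ← map_mul, TwG.rel hab]
  obtain ⟨x, hx⟩ : ∃ x, φ (gen 0) x ≠ x := by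
    by_contra hc
    push Not at hc
    refine TwG.gen_ne_one 0 (hφ ?_)
    rw [map_one]
    ext y
    exact hc y
  -- any element moving `x` has a power moving it up
  have hup : ∀ f : ℝ ≃o ℝ, f x ≠ x → ∃ k : ℝ ≃o ℝ, (k = f ∨ k = f⁻¹) ∧ x < k x := by
    intro f hf
    rcases lt_or_gt_of_ne hf with h | h
    · refine ⟨f⁻¹, Or.inr rfl, ?_⟩
      have h2 := (f⁻¹).strictMono h
      have h3 : f⁻¹ (f x) = x := f.symm_apply_apply x
      rwa [h3] at h2
    · exact ⟨f, Or.inl rfl, h⟩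
  have hmove : ∀ a : ℝ, a ≤ 0 → φ (gen a) x ≠ x := by
    intro a ha
    rcases ha.eq_or_lt with rfl | ha
    · exact hx
    · obtain ⟨k, hk, hkx⟩ := hup _ hx
      rcases hk with rfl | rfl
      · exact (line_lemma (hrel a 0 ha) hkx).1
      · exact (line_lemma (rel_inv_left (hrel a 0 ha)) hkx).1
  have hch : ∀ a : ℝ, ∃ k : ℝ ≃o ℝ, a ≤ 0 → (k = φ (gen a) ∨ k = (φ (gen a))⁻¹) ∧ x < k x := by
    intro a
    by_cases ha : a ≤ 0
    · obtain ⟨k, hk⟩ := hup _ (hmove a ha)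
      exact ⟨k, fun _ => hk⟩
    · exact ⟨1, fun h => absurd h ha⟩
  choose k hk using hch
  have hkrel : ∀ a b : ℝ, a < b → b ≤ 0 → k b * (k a * k b) = k a := by
    intro a b hab hb
    have h0 := hrel a b hab
    rcases (hk a (hab.le.trans hb)).1 with h1 | h1 <;> rcases (hk b hb).1 with h2 | h2 <;>
      rw [h1, h2]
    · exact h0
    · exact rel_inv_left h0
    · exact rel_inv_right h0
    · exact rel_inv_right (rel_inv_left h0)
  have hlt : ∀ a b : ℝ, a < b → b ≤ 0 → k b (k b x) < k a x := by
    intro a b hab hb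
    have hbx := (hk b hb).2
    have h1 : x < (k b * k b) x := hbx.trans ((k b).strictMono hbx)
    exact (line_lemma (rel_sq (hkrel a b hab hb)) h1).2 (hk a (hab.le.trans hb)).2
  have hcount : (Set.Iic (0 : ℝ)).Countable := by
    refine Set.PairwiseDisjoint.countable_of_isOpen
      (s := fun a => Set.Ioo (k a x) (k a (k a x))) ?_ (fun _ _ => isOpen_Ioo) ?_
    · have aux : ∀ a b : ℝ, a < b → b ≤ 0 →
          Disjoint (Set.Ioo (k a x) (k a (k a x))) (Set.Ioo (k b x) (k b (k b x))) := by
        intro a b hab hb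
        rw [Set.disjoint_left]
        rintro z ⟨hz1, _⟩ ⟨_, hz2⟩
        exact lt_asymm (hz1.trans hz2) (hlt a b hab hb)
      intro a ha b hb hab
      rcases lt_or_gt_of_ne hab with h | h
      · exact aux a b h hb
      · exact (aux b a h ha).symm
    · intro a ha
      exact Set.nonempty_Ioo.2 ((k a).strictMono (hk a ha).2)
  have := hcount.le_aleph0
  rw [Cardinal.mk_Iic_real] at this
  exact absurd this (not_le.2 Cardinal.aleph0_lt_continuum)

theorem TwG.card : Cardinal.mk TwG = Cardinal.continuum := by
  change Cardinal.mk (ℝ →₀ ℤ) = _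
  rw [Cardinal.mk_finsupp_of_infinite, Cardinal.mk_real, Cardinal.mk_int]
  exact max_eq_left Cardinal.aleph0_le_continuum

end Twisted

theorem stmt_18 :
    (∀ (G : Type) (instG : Group G), Countable G → @LeftOrderable G instG →
      @EmbedsInHomeoPlusR G instG) ∧
    ∃ (G : Type) (instG : Group G), @LeftOrderable G instG ∧
      Cardinal.mk G = Cardinal.continuum ∧ ¬ @EmbedsInHomeoPlusR G instG := by
  refine ⟨?_, TwG, inferInstance, TwG.leftOrderable, TwG.card, TwG.not_embeds⟩
  intro G instG hG hL
  exact countable_part G hL
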